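/- Let B₁,…,B_k be negatively correlated Bernoulli random variables, a₁,…,a_k ∈ [0,1], B = Σᵢ aᵢBᵢ and μ = E[B]. Then for every ε ∈ (0,1), P[|B − μ| ≥ εμ] ≤ 2·exp(−ε²μ/3). -/

import Mathlib

open MeasureTheory

lemma aux_prod {Ω : Type*} [MeasurableSpace Ω] (μ : Measure Ω) [IsProbabilityMeasure μ]
    (k : ℕ) (B : Fin k → Ω → ℝ) (b : ℝ)
    (hneg : ∀ (I : Finset (Fin k)), ∀ j ∈ I,
      μ ({ω | B j ω = b} ∩ {ω | ∀ i ∈ I.erase j, B i ω = b}) ≤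
        μ {ω | B j ω = b} * μ {ω | ∀ i ∈ I.erase j, B i ω = b}) (I : Finset (Fin k)) :
    μ {ω | ∀ i ∈ I, B i ω = b} ≤ ∏ i ∈ I, μ {ω | B i ω = b} := by
  classical
  induction I using Finset.induction_on with
  | empty => simp
  | insert j I hj ih =>
    have h := hneg (insert j I) j (Finset.mem_insert_self _ _)
    rw [Finset.erase_insert hj] at h
    have e : {ω | ∀ i ∈ insert j I, B i ω = b}
        = {ω | B j ω = b} ∩ {ω | ∀ i ∈ I, B i ω = b} := by
      ext ω; simp
    rw [e, Finset.prod_insert hj]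
    exact h.trans (mul_le_mul_right ih _)

lemma aux_bdd {Ω : Type*} [MeasurableSpace Ω] (μ : Measure Ω) [IsProbabilityMeasure μ]
    (k : ℕ) (X : Fin k → Ω → ℝ) (hmeas : ∀ i, Measurable (X i))
    (hX : ∀ i ω, X i ω = 0 ∨ X i ω = 1) (s : Finset (Fin k)) :
    Integrable (fun ω => ∏ i ∈ s, X i ω) μ := by
  refine Integrable.of_bound (C := 1) (by fun_prop) (ae_of_all _ fun ω => ?_)
  rw [Real.norm_eq_abs, Finset.abs_prod]
  refine Finset.prod_le_one (fun _ _ => abs_nonneg _) (fun i _ => ?_)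
  rcases hX i ω with h | h <;> simp [h]

lemma aux_exp {Ω : Type*} [MeasurableSpace Ω] (μ : Measure Ω) [IsProbabilityMeasure μ]
    (k : ℕ) (X : Fin k → Ω → ℝ) (hmeas : ∀ i, Measurable (X i))
    (hX : ∀ i ω, X i ω = 0 ∨ X i ω = 1)
    (hneg : ∀ I : Finset (Fin k), μ {ω | ∀ i ∈ I, X i ω = 1} ≤ ∏ i ∈ I, μ {ω | X i ω = 1})
    (c : Fin k → ℝ) (hc : ∀ i, 0 ≤ c i) :
    ∫ ω, ∏ i, (1 + c i * X i ω) ∂μ ≤ ∏ i, (1 + c i * ∫ ω, X i ω ∂μ) := by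
  classical
  have key : ∀ I : Finset (Fin k), ∫ ω, ∏ i ∈ I, X i ω ∂μ = μ.real {ω | ∀ i ∈ I, X i ω = 1} := by
    intro I
    have hm : MeasurableSet {ω | ∀ i ∈ I, X i ω = 1} := by
      have : {ω | ∀ i ∈ I, X i ω = 1} = ⋂ i ∈ I, {ω | X i ω = 1} := by ext; simp
      rw [this]
      exact Finset.measurableSet_biInter _ fun i _ => hmeas i (measurableSet_singleton 1)
    rw [← integral_indicator_one hm]
    congr 1
    ext ω
    by_cases h : ∀ i ∈ I, X i ω = 1
    · rw [Set.indicator_of_mem (by exact h), Finset.prod_eq_one h]; rfl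
    · rw [Set.indicator_of_notMem (by exact h)]
      push Not at h
      obtain ⟨i, hi, h⟩ := h
      exact Finset.prod_eq_zero hi ((hX i ω).resolve_right h)
  have key1 : ∀ i, ∫ ω, X i ω ∂μ = μ.real {ω | X i ω = 1} := by
    intro i
    simpa using key {i}
  simp only [Finset.prod_one_add, Finset.prod_mul_distrib]
  rw [integral_finsetSum _ fun s _ => (aux_bdd μ k X hmeas hX s).const_mul _]
  refine Finset.sum_le_sum fun s _ => ?_
  rw [integral_const_mul]
  refine mul_le_mul_of_nonneg_left ?_ (Finset.prod_nonneg fun i _ => hc i)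
  rw [key]
  simp only [key1, Measure.real]
  rw [← ENNReal.toReal_prod]
  exact ENNReal.toReal_mono (ENNReal.prod_ne_top fun i _ => measure_ne_top _ _) (hneg s)

lemma aux_convex (t a : ℝ) (h0 : 0 ≤ a) (h1 : a ≤ 1) :
    Real.exp (t * a) - 1 ≤ a * (Real.exp t - 1) := by
  have := convexOn_exp.2 (Set.mem_univ 0) (Set.mem_univ t) (sub_nonneg.2 h1) h0 (by ring)
  simp only [smul_eq_mul, mul_zero, zero_add, Real.exp_zero, mul_one] at this
  rw [mul_comm t a]
  linarith

lemma aux_mgf {Ω : Type*} [MeasurableSpace Ω] (μ : Measure Ω) [IsProbabilityMeasure μ]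
    (k : ℕ) (B : Fin k → Ω → ℝ) (hmeas : ∀ i, Measurable (B i))
    (hBern : ∀ i ω, B i ω = 0 ∨ B i ω = 1)
    (hneg : ∀ (I : Finset (Fin k)), ∀ j ∈ I, ∀ b ∈ ({0, 1} : Set ℝ),
      μ ({ω | B j ω = b} ∩ {ω | ∀ i ∈ I.erase j, B i ω = b}) ≤
        μ {ω | B j ω = b} * μ {ω | ∀ i ∈ I.erase j, B i ω = b})
    (a : Fin k → ℝ) (ha0 : ∀ i, 0 ≤ a i) (ha1 : ∀ i, a i ≤ 1) (t : ℝ) :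
    ProbabilityTheory.mgf (fun ω => ∑ i, a i * B i ω) μ t ≤
      Real.exp ((∫ x, (∑ i, a i * B i x) ∂μ) * (Real.exp t - 1)) := by
  have hint : ∀ i, Integrable (B i) μ := fun i => by
    simpa using aux_bdd μ k B hmeas hBern {i}
  have hp0 : ∀ i, 0 ≤ ∫ ω, B i ω ∂μ := fun i => integral_nonneg fun ω => by
    rcases hBern i ω with h | h <;> simp [h]
  have hp1 : ∀ i, ∫ ω, B i ω ∂μ ≤ 1 := fun i => by
    have := integral_mono (hint i) (integrable_const (μ := μ) (1 : ℝ)) (fun ω => by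
      rcases hBern i ω with h | h <;> simp [h])
    simpa using this
  have step : ProbabilityTheory.mgf (fun ω => ∑ i, a i * B i ω) μ t ≤
      ∏ i, (1 + (Real.exp (t * a i) - 1) * ∫ ω, B i ω ∂μ) := by
    unfold ProbabilityTheory.mgf
    rcases le_total 0 t with ht | ht
    · have e : ∀ ω, Real.exp (t * ∑ i, a i * B i ω)
          = ∏ i, (1 + (Real.exp (t * a i) - 1) * B i ω) := by
        intro ω
        rw [Finset.mul_sum, Real.exp_sum]
        refine Finset.prod_congr rfl fun i _ => ?_
        rcases hBern i ω with h | h <;> simp [h]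
      simp only [e]
      refine aux_exp μ k B hmeas hBern
        (aux_prod μ k B 1 fun I j hj => hneg I j hj 1 (by simp)) _ fun i => ?_
      rw [sub_nonneg]
      exact Real.one_le_exp (mul_nonneg ht (ha0 i))
    · have e : ∀ ω, Real.exp (t * ∑ i, a i * B i ω)
          = (∏ i, Real.exp (t * a i)) *
            ∏ i, (1 + (Real.exp (-(t * a i)) - 1) * (1 - B i ω)) := by
        intro ω
        rw [Finset.mul_sum, Real.exp_sum, ← Finset.prod_mul_distrib]
        refine Finset.prod_congr rfl fun i _ => ?_
        rcases hBern i ω with h | h <;> simp [h, ← Real.exp_add]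
      simp only [e]
      rw [integral_const_mul]
      have h1 := aux_exp μ k (fun i ω => 1 - B i ω) (fun i => by fun_prop)
        (fun i ω => by rcases hBern i ω with h | h <;> simp [h])
        (by
          intro I
          have := aux_prod μ k B 0 (fun I j hj => hneg I j hj 0 (by simp)) I
          simpa using this)
        (fun i => Real.exp (-(t * a i)) - 1) (fun i => by
          rw [sub_nonneg]
          exact Real.one_le_exp (by nlinarith [ha0 i]))
      refine (mul_le_mul_of_nonneg_left h1
        (Finset.prod_nonneg fun i _ => (Real.exp_pos _).le)).trans_eq ?_
      rw [← Finset.prod_mul_distrib]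
      refine Finset.prod_congr rfl fun i _ => ?_
      rw [integral_sub (integrable_const _) (hint i)]
      have : Real.exp (t * a i) * Real.exp (-(t * a i)) = 1 := by simp [← Real.exp_add]
      simp only [integral_const, probReal_univ, smul_eq_mul, mul_one]
      linear_combination (1 - ∫ ω, B i ω ∂μ) * this
  refine step.trans ?_
  rw [integral_finsetSum _ fun i _ => (hint i).const_mul _, Finset.sum_mul, Real.exp_sum]
  refine Finset.prod_le_prod (fun i _ => ?_) fun i _ => ?_
  · nlinarith [hp0 i, hp1 i, mul_nonneg (Real.exp_pos (t * a i)).le (hp0 i)]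
  · rw [integral_const_mul]
    have h1 := Real.add_one_le_exp (a i * (∫ ω, B i ω ∂μ) * (Real.exp t - 1))
    have h2 := mul_le_mul_of_nonneg_right (aux_convex t (a i) (ha0 i) (ha1 i)) (hp0 i)
    linarith

/-- Chernoff bound for negatively correlated Bernoulli random variables.
If `B₁,…,B_k ∈ {0,1}` are negatively correlated (for every index set `I`, every `j ∈ I`
and every `b ∈ {0,1}`, the event `B_j = b` and the event `∀ i ∈ I∖{j}, B_i = b` are
negatively correlated), `a₁,…,a_k ∈ [0,1]`, `B = ∑ aᵢ Bᵢ` and `μ' = E[B]`, then for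
every `ε ∈ (0,1)`, `P[|B - μ'| ≥ ε μ'] ≤ 2 exp(-ε² μ' / 3)`. -/
theorem stmt8 {Ω : Type*} [MeasurableSpace Ω] (μ : Measure Ω) [IsProbabilityMeasure μ]
    (k : ℕ) (B : Fin k → Ω → ℝ) (hmeas : ∀ i, Measurable (B i))
    (hBern : ∀ i ω, B i ω = 0 ∨ B i ω = 1)
    (hneg : ∀ (I : Finset (Fin k)), ∀ j ∈ I, ∀ b ∈ ({0, 1} : Set ℝ),
      μ ({ω | B j ω = b} ∩ {ω | ∀ i ∈ I.erase j, B i ω = b}) ≤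
        μ {ω | B j ω = b} * μ {ω | ∀ i ∈ I.erase j, B i ω = b})
    (a : Fin k → ℝ) (ha0 : ∀ i, 0 ≤ a i) (ha1 : ∀ i, a i ≤ 1)
    (ε : ℝ) (hε0 : 0 < ε) (hε1 : ε < 1) :
    μ {ω | ε * (∫ x, (∑ i, a i * B i x) ∂μ) ≤
        |(∑ i, a i * B i ω) - ∫ x, (∑ i, a i * B i x) ∂μ|} ≤
      ENNReal.ofReal (2 * Real.exp (-(ε ^ 2 * (∫ x, (∑ i, a i * B i x) ∂μ)) / 3)) := by
  set m := ∫ x, (∑ i, a i * B i x) ∂μ with hm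
  have hm0 : 0 ≤ m := integral_nonneg fun ω => Finset.sum_nonneg fun i _ =>
    mul_nonneg (ha0 i) (by rcases hBern i ω with h | h <;> simp [h])
  have hmgf := aux_mgf μ k B hmeas hBern hneg a ha0 ha1
  have hS : ∀ ω, |∑ i, a i * B i ω| ≤ ∑ i, a i := fun ω => by
    refine (Finset.abs_sum_le_sum_abs _ _).trans (Finset.sum_le_sum fun i _ => ?_)
    rcases hBern i ω with h | h <;> simp [h, ha0 i, abs_of_nonneg]
  have hint : ∀ t : ℝ, Integrable (fun ω => Real.exp (t * ∑ i, a i * B i ω)) μ := fun t => by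
    refine Integrable.of_bound (C := Real.exp (|t| * ∑ i, a i)) (by fun_prop)
      (ae_of_all _ fun ω => ?_)
    rw [Real.norm_eq_abs, Real.abs_exp]
    refine Real.exp_le_exp.2 ((le_abs_self _).trans ?_)
    rw [abs_mul]
    exact mul_le_mul_of_nonneg_left (hS ω) (abs_nonneg t)
  have hup : μ.real {ω | (1 + ε) * m ≤ ∑ i, a i * B i ω} ≤ Real.exp (-(ε ^ 2 * m) / 3) := by
    have hlog := Real.le_log_one_add_of_nonneg hε0.le
    have h := ProbabilityTheory.measure_ge_le_exp_mul_mgf (μ := μ)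
      (X := fun ω => ∑ i, a i * B i ω) ((1 + ε) * m)
      (Real.log_nonneg (by linarith : 1 ≤ 1 + ε)) (hint _)
    refine h.trans ((mul_le_mul_of_nonneg_left (hmgf _) (Real.exp_pos _).le).trans ?_)
    rw [← Real.exp_add, Real.exp_le_exp, Real.exp_log (by linarith)]
    have h3 : ε + ε ^ 2 / 3 ≤ (1 + ε) * Real.log (1 + ε) := by
      refine le_trans ?_ (mul_le_mul_of_nonneg_left hlog (by linarith))
      rw [← mul_div_assoc, le_div_iff₀ (by linarith)]
      nlinarith [mul_nonneg (sq_nonneg ε) (sub_nonneg.2 hε1.le)]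
    nlinarith [mul_le_mul_of_nonneg_left h3 hm0]
  have hlo : μ.real {ω | ∑ i, a i * B i ω ≤ (1 - ε) * m} ≤ Real.exp (-(ε ^ 2 * m) / 3) := by
    have h := ProbabilityTheory.measure_le_le_exp_mul_mgf (μ := μ)
      (X := fun ω => ∑ i, a i * B i ω) ((1 - ε) * m)
      (by linarith : -ε ≤ 0) (hint _)
    refine h.trans ((mul_le_mul_of_nonneg_left (hmgf _) (Real.exp_pos _).le).trans ?_)
    rw [← Real.exp_add, Real.exp_le_exp]
    have h3 : Real.exp (-ε) ≤ 1 - ε + ε ^ 2 / 2 := by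
      have hq := Real.quadratic_le_exp_of_nonneg hε0.le
      have hone : Real.exp (-ε) * Real.exp ε = 1 := by simp [← Real.exp_add]
      have hpos : 0 ≤ 1 - ε + ε ^ 2 / 2 := by nlinarith
      have h4 := mul_le_mul_of_nonneg_left hq hpos
      have h5 : 1 ≤ (1 - ε + ε ^ 2 / 2) * Real.exp ε := by nlinarith [sq_nonneg (ε ^ 2)]
      exact le_of_mul_le_mul_right (by linarith) (Real.exp_pos ε)
    nlinarith [mul_le_mul_of_nonneg_left h3 hm0, mul_nonneg hm0 (sq_nonneg ε)]
  rw [← ofReal_measureReal]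
  refine ENNReal.ofReal_le_ofReal ?_
  have hsub : {ω | ε * m ≤ |(∑ i, a i * B i ω) - m|} ⊆
      {ω | (1 + ε) * m ≤ ∑ i, a i * B i ω} ∪ {ω | ∑ i, a i * B i ω ≤ (1 - ε) * m} := by
    intro ω hω
    rcases le_abs.1 (show ε * m ≤ |(∑ i, a i * B i ω) - m| from hω) with h | h
    · left
      show (1 + ε) * m ≤ _
      linarith
    · right
      show _ ≤ (1 - ε) * m
      linarith
  have h1 := (measureReal_mono (μ := μ) hsub).trans (measureReal_union_le _ _)
  linarith
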